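/- Let p be prime, q = p^h, and f_1, …, f_s ∈ ℤ_q[x_1, …, x_n] nonzero polynomials. For given m_1, …, m_s ≥ 1, let V = {X ∈ T_q^n : f_k(X) ≡ 0 (mod p^{m_k}) for all k}. Then ord_q(|V|) ≥ ⌈(n − Σ_k ((p^{m_k} − 1)/(p − 1))·deg f_k) / max_k (p^{m_k − 1}·deg f_k)⌉*, where ⌈t⌉* is the least nonnegative integer ≥ t. -/

import Mathlib

open Finset

/-- The base-`p` digits of `j`, with the `t`-th digit weighted by `p ^ ((t + l) % h)`: a
representative of `p ^ l * j` modulo `p ^ h - 1`. -/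
def cyclicWeight (p h : ℕ) (l j : ℕ) : ℕ :=
  if _hj : j = 0 ∨ p ≤ 1 then 0 else (j % p) * p ^ (l % h) + cyclicWeight p h (l + 1) (j / p)
termination_by j
decreasing_by exact Nat.div_lt_self (by omega) (by omega)

section cyclicWeight

variable {p h : ℕ}

theorem cyclicWeight_zero (l : ℕ) : cyclicWeight p h l 0 = 0 := by
  rw [cyclicWeight]; simp

theorem cyclicWeight_of_ne_zero (hp : 1 < p) (l : ℕ) {j : ℕ} (hj : j ≠ 0) :
    cyclicWeight p h l j = (j % p) * p ^ (l % h) + cyclicWeight p h (l + 1) (j / p) := by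
  rw [cyclicWeight, dif_neg (by omega)]

theorem cyclicWeight_pos (hp : 1 < p) (l : ℕ) {j : ℕ} (hj : j ≠ 0) :
    0 < cyclicWeight p h l j := by
  induction j using Nat.strong_induction_on generalizing l with
  | _ j ih =>
    rw [cyclicWeight_of_ne_zero hp l hj]
    by_cases hjp : j / p = 0
    · have : j % p = j := Nat.mod_eq_of_lt ((Nat.div_eq_zero_iff_lt (by omega)).1 hjp)
      rw [this]
      have : 0 < j * p ^ (l % h) := by positivity
      omega
    · have := ih (j / p) (Nat.div_lt_self (by omega) hp) (l + 1) hjp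
      omega

theorem pow_mod_modEq (hp : 1 < p) (l : ℕ) : p ^ (l % h) ≡ p ^ l [MOD p ^ h - 1] := by
  have h1 : p ^ h ≡ 1 [MOD p ^ h - 1] :=
    ((Nat.modEq_iff_dvd' (Nat.one_le_pow _ _ (by omega))).2 dvd_rfl).symm
  conv_rhs => rw [← Nat.mod_add_div l h, pow_add, pow_mul]
  simpa using (Nat.ModEq.refl (p ^ (l % h))).mul (h1.pow (l / h)).symm

theorem cyclicWeight_modEq (hp : 1 < p) (l j : ℕ) :
    cyclicWeight p h l j ≡ p ^ l * j [MOD p ^ h - 1] := by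
  induction j using Nat.strong_induction_on generalizing l with
  | _ j ih =>
    by_cases hj : j = 0
    · simp [hj, cyclicWeight_zero, Nat.ModEq.refl]
    rw [cyclicWeight_of_ne_zero hp l hj]
    have h1 := ih (j / p) (Nat.div_lt_self (by omega) hp) (l + 1)
    have h2 := ((Nat.ModEq.refl (j % p)).mul (pow_mod_modEq (h := h) hp l)).add h1
    have h3 : j % p * p ^ l + p ^ (l + 1) * (j / p) = p ^ l * j := by
      conv_rhs => rw [← Nat.mod_add_div j p]
      ring
    rwa [h3] at h2

theorem sum_pow_add_mod (t : ℕ) :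
    ∑ l ∈ range h, p ^ ((l + t) % h) = ∑ l ∈ range h, p ^ l := by
  induction t with
  | zero => exact sum_congr rfl fun l hl => by rw [add_zero, Nat.mod_eq_of_lt (mem_range.1 hl)]
  | succ t ih =>
    rw [← ih]
    have h1 := sum_range_succ (fun l => p ^ ((l + t) % h)) h
    have h2 := sum_range_succ' (fun l => p ^ ((l + t) % h)) h
    simp only [zero_add, Nat.add_mod_left] at h1 h2
    rw [h1] at h2
    simp only [add_assoc, add_comm 1 t] at h2
    omega

theorem sum_cyclicWeight (hp : 1 < p) (t j : ℕ) :
    ∑ l ∈ range h, cyclicWeight p h (l + t) j = (p.digits j).sum * ∑ l ∈ range h, p ^ l := by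
  induction j using Nat.strong_induction_on generalizing t with
  | _ j ih =>
    by_cases hj : j = 0
    · simp [hj, cyclicWeight_zero]
    simp only [cyclicWeight_of_ne_zero hp _ hj, sum_add_distrib, ← mul_sum, sum_pow_add_mod,
      add_assoc, ih (j / p) (Nat.div_lt_self (by omega) hp) (t + 1)]
    rw [Nat.digits_def' hp (Nat.pos_of_ne_zero hj), List.sum_cons]
    ring

end cyclicWeight

theorem sum_digits_pow_sub_one_mul_pow {p : ℕ} (hp : 1 < p) (h M : ℕ) :
    (p.digits ((p ^ h - 1) * p ^ M)).sum = h * (p - 1) := by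
  rcases Nat.eq_zero_or_pos h with rfl | hh
  · simp
  have hpos : 0 < p ^ h - 1 := by
    have := Nat.one_lt_pow hh.ne' hp
    omega
  rw [mul_comm, Nat.digits_base_pow_mul hp hpos, List.sum_append, List.sum_replicate, smul_zero,
    zero_add]
  clear hpos hh
  induction h with
  | zero => simp
  | succ h ih =>
    have h1 : 1 ≤ p ^ h := Nat.one_le_pow _ _ (by omega)
    have h2 : p ^ (h + 1) - 1 = (p - 1) + p * (p ^ h - 1) := by
      zify [h1, hp.le, Nat.one_le_pow (h + 1) p (by omega)]
      ring
    rw [h2, Nat.digits_add p hp _ _ (by omega) (Or.inl (by omega)), List.sum_cons, ih]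
    ring

theorem sub_one_mul_padicValNat_multinomial {α : Type*} (p : ℕ) [hp : Fact p.Prime] (s : Finset α)
    (j : α → ℕ) :
    (p - 1) * padicValNat p (Nat.multinomial s j) + (p.digits (∑ i ∈ s, j i)).sum =
      ∑ i ∈ s, (p.digits (j i)).sum := by
  have hfac (n : ℕ) : (p - 1) * padicValNat p n.factorial + (p.digits n).sum = n := by
    rw [sub_one_mul_padicValNat_factorial, Nat.sub_add_cancel (Nat.digit_sum_le p n)]
  have hne : Nat.multinomial s j ≠ 0 := (Nat.multinomial_pos s j).ne'
  have hprod : padicValNat p (∏ i ∈ s, (j i).factorial) =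
      ∑ i ∈ s, padicValNat p (j i).factorial := by
    classical
    induction s using Finset.induction_on with
    | empty => simp
    | insert a s ha ih =>
      rw [prod_insert ha, sum_insert ha, padicValNat.mul (Nat.factorial_ne_zero _)
        (prod_ne_zero_iff.2 fun i _ => Nat.factorial_ne_zero _), ih (Nat.multinomial_pos s j).ne']
  have hspec := congrArg (padicValNat p) (Nat.multinomial_spec s j)
  rw [padicValNat.mul (prod_ne_zero_iff.2 fun i _ => Nat.factorial_ne_zero _) hne, hprod] at hspec
  have hsum := sum_congr rfl fun i (_ : i ∈ s) => hfac (j i)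
  rw [sum_add_distrib, ← mul_sum] at hsum
  have htot := hfac (∑ i ∈ s, j i)
  rw [← hspec] at htot
  nlinarith

theorem mul_le_sum_padicValNat_multinomial {p h n b D M : ℕ} [hp : Fact p.Prime] (hh : 0 < h)
    {ι : Type*} [Fintype ι] {d : ι → ℕ} (hD : ∀ k, d k ≤ D) (hD0 : 0 < D)
    (hb : D * b + ∑ k, d k < n + D) (s : ι → Finset (Fin n →₀ ℕ))
    (hs : ∀ k, ∀ i ∈ s k, ∑ c, i c ≤ d k) (J : ι → (Fin n →₀ ℕ) → ℕ)
    (hJ : ∀ k, ∑ i ∈ s k, J k i = (p ^ h - 1) * p ^ M)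
    (he : ∀ c, p ^ h - 1 ∣ ∑ k, ∑ i ∈ s k, J k i * i c) :
    h * b ≤ ∑ k, padicValNat p (Nat.multinomial (s k) (J k)) +
      h * #{c | ∑ k, ∑ i ∈ s k, J k i * i c = 0} := by
  have hp1 : 1 < p := hp.out.one_lt
  set Q := p ^ h - 1 with hQ
  set G := ∑ l ∈ range h, p ^ l with hG
  have hQ0 : 0 < Q := by
    have := Nat.one_lt_pow hh.ne' hp1
    omega
  have hGQ : (p - 1) * G = Q := by
    rw [hG, mul_comm, hQ]
    zify [hp1.le, Nat.one_le_pow h p (by omega)]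
    exact geom_sum_mul (p : ℤ) h
  let w (l j : ℕ) := cyclicWeight p h l j
  have hwe : ∀ l k, ∃ e, ∑ i ∈ s k, w l (J k i) = Q * (1 + e) := by
    intro l k
    have hmod : ∑ i ∈ s k, w l (J k i) ≡ 0 [MOD Q] := by
      have h1 : ∑ i ∈ s k, w l (J k i) ≡ ∑ i ∈ s k, p ^ l * J k i [MOD Q] :=
        Nat.ModEq.sum fun i _ => cyclicWeight_modEq hp1 l (J k i)
      rw [← mul_sum, hJ] at h1
      exact h1.trans ((Nat.modEq_zero_iff_dvd).2 ⟨p ^ l * p ^ M, by ring⟩)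
    obtain ⟨e, hE⟩ := (Nat.modEq_zero_iff_dvd).1 hmod
    have hpos : 0 < ∑ i ∈ s k, w l (J k i) := by
      have h0 : 0 < ∑ i ∈ s k, J k i := by rw [hJ]; positivity
      obtain ⟨i, hi, hi0⟩ := exists_ne_zero_of_sum_ne_zero h0.ne'
      exact sum_pos' (fun _ _ => Nat.zero_le _) ⟨i, hi, cyclicWeight_pos hp1 l hi0⟩
    rcases e with _ | e
    · simp [hE] at hpos
    · exact ⟨e, by rw [hE, add_comm]⟩
  choose e he' using hwe
  have hval : ∀ k, padicValNat p (Nat.multinomial (s k) (J k)) = ∑ l ∈ range h, e l k := by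
    intro k
    have h1 := sub_one_mul_padicValNat_multinomial p (s k) (J k)
    rw [hJ, sum_digits_pow_sub_one_mul_pow hp1] at h1
    have h2 : ∑ l ∈ range h, ∑ i ∈ s k, w l (J k i) = (∑ i ∈ s k, (p.digits (J k i)).sum) * G := by
      rw [sum_comm, sum_mul]
      exact sum_congr rfl fun i _ => sum_cyclicWeight hp1 0 (J k i)
    rw [← h1, sum_congr rfl fun l _ => he' l k, ← mul_sum, sum_add_distrib] at h2
    simp only [sum_const, card_range, smul_eq_mul, mul_one] at h2
    have h3 : Q * (h + ∑ l ∈ range h, e l k) =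
        Q * (h + padicValNat p (Nat.multinomial (s k) (J k))) := by
      rw [h2, ← hGQ]; ring
    have := Nat.eq_of_mul_eq_mul_left hQ0 h3
    omega
  set u := #{c | ∑ k, ∑ i ∈ s k, J k i * i c = 0} with hu
  have hl : ∀ l, b ≤ ∑ k, e l k + u := by
    intro l
    have hc : ∀ c, ∑ k, ∑ i ∈ s k, J k i * i c ≠ 0 → Q ≤ ∑ k, ∑ i ∈ s k, w l (J k i) * i c := by
      intro c hc
      have hmod : ∑ k, ∑ i ∈ s k, w l (J k i) * i c ≡ 0 [MOD Q] := by
        have h1 : ∑ k, ∑ i ∈ s k, w l (J k i) * i c ≡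
            ∑ k, ∑ i ∈ s k, p ^ l * J k i * i c [MOD Q] :=
          Nat.ModEq.sum fun k _ => Nat.ModEq.sum fun i _ =>
            (cyclicWeight_modEq hp1 l (J k i)).mul_right _
        simp only [mul_assoc, ← mul_sum] at h1
        exact h1.trans ((Nat.modEq_zero_iff_dvd).2 ((he c).mul_left _))
      refine Nat.le_of_dvd ?_ ((Nat.modEq_zero_iff_dvd).1 hmod)
      obtain ⟨k, _, hk⟩ := exists_ne_zero_of_sum_ne_zero hc
      obtain ⟨i, hi, hi0⟩ := exists_ne_zero_of_sum_ne_zero hk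
      refine sum_pos' (fun _ _ => Nat.zero_le _) ⟨k, mem_univ _, ?_⟩
      refine sum_pos' (fun _ _ => Nat.zero_le _) ⟨i, hi, ?_⟩
      exact Nat.mul_pos (cyclicWeight_pos hp1 l (left_ne_zero_of_mul hi0))
        (Nat.pos_of_ne_zero (right_ne_zero_of_mul hi0))
    have hlow : Q * n ≤ Q * u + ∑ c, ∑ k, ∑ i ∈ s k, w l (J k i) * i c := by
      have h1 : ∑ _c : Fin n, Q ≤ ∑ c : Fin n,
          ((if ∑ k, ∑ i ∈ s k, J k i * i c = 0 then Q else 0) +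
            ∑ k, ∑ i ∈ s k, w l (J k i) * i c) := by
        refine sum_le_sum fun c _ => ?_
        split_ifs with h0
        · omega
        · have := hc c h0
          omega
      rw [sum_add_distrib, ← sum_filter] at h1
      simp only [sum_const, card_univ, Fintype.card_fin, smul_eq_mul] at h1
      rwa [mul_comm n, mul_comm _ Q] at h1
    have hup : ∑ c, ∑ k, ∑ i ∈ s k, w l (J k i) * i c ≤ Q * (∑ k, d k + D * ∑ k, e l k) := by
      rw [sum_comm, mul_sum, ← sum_add_distrib, mul_sum]
      refine sum_le_sum fun k _ => ?_
      rw [sum_comm]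
      calc ∑ i ∈ s k, ∑ c, w l (J k i) * i c ≤ ∑ i ∈ s k, w l (J k i) * d k := by
            refine sum_le_sum fun i hi => ?_
            rw [← mul_sum]
            exact Nat.mul_le_mul_left _ (hs k i hi)
        _ = Q * (d k + d k * e l k) := by rw [← sum_mul, he']; ring
        _ ≤ Q * (d k + D * e l k) := by gcongr; exact hD k
    have h1 : n ≤ u + (∑ k, d k + D * ∑ k, e l k) :=
      Nat.le_of_mul_le_mul_left (by linarith) hQ0
    have h2 : D * b < D * (∑ k, e l k + u + 1) := by nlinarith
    exact Nat.lt_succ_iff.1 (Nat.lt_of_mul_lt_mul_left h2)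
  calc h * b = ∑ l ∈ range h, b := by simp
    _ ≤ ∑ l ∈ range h, (∑ k, e l k + u) := sum_le_sum fun l _ => hl l
    _ = _ := by rw [sum_add_distrib, sum_comm, sum_congr rfl fun k _ => hval k]; simp

section AxKatz

variable {p : ℕ} [hp : Fact p.Prime] {F : Type*} [Field F] [Fintype F] [CharP F p]

theorem WittVector.teichmuller_injective (p : ℕ) [Fact p.Prime] (R : Type*) [CommRing R] :
    Function.Injective (teichmuller p (R := R)) := fun x y hxy => by
  rw [← teichmuller_coeff_zero p x, hxy, teichmuller_coeff_zero]

theorem WittVector.natCast_dvd_iff (w : WittVector p F) :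
    (p : WittVector p F) ∣ w ↔ constantCoeff w = 0 := by
  rw [← Ideal.mem_span_singleton, mem_span_p_iff_coeff_zero_eq_zero]; rfl

theorem WittVector.pow_dvd_natCast_iff (c N : ℕ) :
    (p : WittVector p F) ^ c ∣ (N : WittVector p F) ↔ p ^ c ∣ N := by
  refine ⟨fun h => ?_, fun h => by exact_mod_cast Nat.cast_dvd_cast h⟩
  induction c generalizing N with
  | zero => simp
  | succ c ih =>
    have h1 : (p : WittVector p F) ∣ (N : WittVector p F) :=
      (dvd_pow_self _ (Nat.succ_ne_zero c)).trans h
    rw [natCast_dvd_iff, map_natCast, CharP.cast_eq_zero_iff F p] at h1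
    obtain ⟨N, rfl⟩ := h1
    rw [pow_succ', Nat.cast_mul, mul_dvd_mul_iff_left (p_nonzero p F)] at h
    rw [pow_succ']
    exact mul_dvd_mul_left _ (ih N h)

theorem sum_teichmuller_pow_eq_zero {e : ℕ} (he : ¬ Fintype.card F - 1 ∣ e) :
    ∑ t : F, WittVector.teichmuller p t ^ e = 0 := by
  classical
  obtain ⟨g, hg⟩ := IsCyclic.exists_generator (α := Fˣ)
  have hge : (g : F) ^ e ≠ 1 := by
    intro h
    apply he
    rw [← Fintype.card_units, ← Nat.card_eq_fintype_card, ← orderOf_eq_card_of_forall_mem_zpowers hg]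
    exact orderOf_dvd_of_pow_eq_one (Units.ext (by simpa using h))
  have hS : WittVector.teichmuller p ((g : F) ^ e) * ∑ t : F, WittVector.teichmuller p t ^ e =
      ∑ t : F, WittVector.teichmuller p t ^ e := by
    rw [mul_sum, ← Equiv.sum_comp (Units.mulLeft g) fun t => WittVector.teichmuller p t ^ e]
    refine sum_congr rfl fun t _ => ?_
    rw [Units.mulLeft_apply, map_mul, mul_pow, map_pow]
  rw [← sub_eq_zero, ← sub_one_mul, mul_eq_zero, sub_eq_zero] at hS
  refine hS.resolve_left fun h => hge ?_
  rw [← map_one (WittVector.teichmuller p)] at h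
  exact WittVector.teichmuller_injective p F h

theorem pow_dvd_sum_prod_pow {h n b D M : ℕ} (hh : 0 < h) (hF : Fintype.card F = p ^ h)
    {ι : Type*} [Fintype ι] {d : ι → ℕ} (hD : ∀ k, d k ≤ D) (hD0 : 0 < D)
    (hb : D * b + ∑ k, d k < n + D) (s : ι → Finset (Fin n →₀ ℕ))
    (hs : ∀ k, ∀ i ∈ s k, ∑ c, i c ≤ d k) (a : ι → (Fin n →₀ ℕ) → WittVector p F) :
    (p : WittVector p F) ^ (h * b) ∣ ∑ x : Fin n → F, ∏ k, (∑ i ∈ s k, a k i *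
      ∏ c, WittVector.teichmuller p (x c) ^ i c) ^ ((p ^ h - 1) * p ^ M) := by
  classical
  simp only [sum_pow_eq_sum_piAntidiag, prod_univ_sum]
  rw [sum_comm]
  refine dvd_sum fun J hJ => ?_
  simp only [Fintype.mem_piFinset, mem_piAntidiag] at hJ
  let e (c : Fin n) := ∑ k, ∑ i ∈ s k, J k i * i c
  have hterm (x : Fin n → F) : ∏ k, ((Nat.multinomial (s k) (J k) : WittVector p F) *
        ∏ i ∈ s k, (a k i * ∏ c, WittVector.teichmuller p (x c) ^ i c) ^ J k i) =
      ((∏ k, Nat.multinomial (s k) (J k) : ℕ) : WittVector p F) * (∏ k, ∏ i ∈ s k, a k i ^ J k i) *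
        ∏ c, WittVector.teichmuller p (x c) ^ e c := by
    simp only [mul_pow, prod_mul_distrib, ← prod_pow, ← pow_mul, Nat.cast_prod, mul_assoc]
    congr 2
    simp only [e, ← prod_pow_eq_pow_sum]
    rw [prod_comm (s := (univ : Finset (Fin n)))]
    refine prod_congr rfl fun k _ => ?_
    rw [prod_comm]
    simp only [mul_comm]
  simp only [hterm, ← mul_sum]
  have hsum : ∑ x : Fin n → F, ∏ c, WittVector.teichmuller p (x c) ^ e c =
      ∏ c, ∑ t : F, WittVector.teichmuller p t ^ e c := by
    rw [prod_univ_sum, Fintype.piFinset_univ]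
  rw [hsum]
  by_cases he : ∀ c, p ^ h - 1 ∣ e c
  swap
  · push Not at he
    obtain ⟨c, hc⟩ := he
    rw [prod_eq_zero (mem_univ c) (sum_teichmuller_pow_eq_zero (hF ▸ hc)), mul_zero]
    exact dvd_zero _
  have hle := mul_le_sum_padicValNat_multinomial hh hD hD0 hb s hs J (fun k => (hJ k).1) he
  refine (pow_dvd_pow _ hle).trans ?_
  rw [pow_add, mul_right_comm]
  refine (mul_dvd_mul ?_ ?_).mul_right _
  · rw [WittVector.pow_dvd_natCast_iff, ← prod_pow_eq_pow_sum]
    exact prod_dvd_prod_of_dvd _ _ fun k _ => pow_padicValNat_dvd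
  · rw [pow_mul, ← prod_const, prod_filter]
    refine prod_dvd_prod_of_dvd _ _ fun c _ => ?_
    split_ifs with h0
    · have : e c = 0 := h0
      simp [this, hF]
    · exact one_dvd _

/-- The **Ax–Katz theorem**, with upper bounds `d k` for the degrees. -/
theorem ax_katz {h n b D : ℕ} (hh : 0 < h) (hF : Fintype.card F = p ^ h)
    {ι : Type*} [Fintype ι] {d : ι → ℕ} (hD : ∀ k, d k ≤ D) (hD0 : 0 < D)
    (hb : D * b + ∑ k, d k < n + D) (g : ι → MvPolynomial (Fin n) F)
    (hg : ∀ k, (g k).totalDegree ≤ d k) :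
    (p ^ h) ^ b ∣ {x : Fin n → F | ∀ k, MvPolynomial.eval x (g k) = 0}.ncard := by
  classical
  let G (k : ι) (x : Fin n → F) : WittVector p F := ∑ i ∈ (g k).support,
    WittVector.teichmuller p ((g k).coeff i) * ∏ c, WittVector.teichmuller p (x c) ^ i c
  have hG (k x) : WittVector.constantCoeff (G k x) = MvPolynomial.eval x (g k) := by
    have ht (r : F) : WittVector.constantCoeff (WittVector.teichmuller p r) = r :=
      WittVector.teichmuller_coeff_zero p r
    rw [MvPolynomial.eval_eq']
    simp only [G, map_sum, map_mul, map_prod, map_pow, ht]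
  let E := (p ^ h - 1) * p ^ (h * b)
  have hQ0 : p ^ h - 1 ≠ 0 := by
    have := Nat.one_lt_pow hh.ne' hp.out.one_lt
    omega
  have hzero (k x) (h0 : MvPolynomial.eval x (g k) = 0) :
      (p : WittVector p F) ^ (h * b) ∣ G k x ^ E := by
    rw [← hG, ← WittVector.natCast_dvd_iff] at h0
    refine (pow_dvd_pow_of_dvd h0 _).trans (pow_dvd_pow _ ?_)
    exact (Nat.lt_pow_self hp.out.one_lt).le.trans
      (Nat.le_mul_of_pos_left _ (Nat.pos_of_ne_zero hQ0))
  have hone (k x) (h0 : MvPolynomial.eval x (g k) ≠ 0) :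
      (p : WittVector p F) ^ (h * b) ∣ 1 - G k x ^ E := by
    have h1 : (p : WittVector p F) ∣ 1 - G k x ^ (p ^ h - 1) := by
      rw [WittVector.natCast_dvd_iff, map_sub, map_pow, map_one, hG, ← hF,
        FiniteField.pow_card_sub_one_eq_one _ h0, sub_self]
    have h2 := dvd_sub_pow_of_dvd_sub h1 (h * b)
    rw [one_pow, ← pow_mul] at h2
    exact (pow_dvd_pow _ (Nat.le_succ _)).trans h2
  have hcount : (p : WittVector p F) ^ (h * b) ∣
      ∑ x : Fin n → F, ∏ k, (1 - G k x ^ E) -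
        ∑ x : Fin n → F, if ∀ k, MvPolynomial.eval x (g k) = 0 then 1 else 0 := by
    rw [← sum_sub_distrib]
    refine dvd_sum fun x _ => ?_
    split_ifs with h0
    · have h1 : ∀ k, 1 - G k x ^ E ≡ 1 [SMOD Ideal.span {(p : WittVector p F) ^ (h * b)}] := by
        intro k
        rw [SModEq.sub_mem, Ideal.mem_span_singleton, sub_sub_cancel_left, dvd_neg]
        exact hzero k x (h0 k)
      have h2 := SModEq.prod (s := univ) fun k _ => h1 k
      rwa [prod_const_one, SModEq.sub_mem, Ideal.mem_span_singleton] at h2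
    · push Not at h0
      obtain ⟨k, hk⟩ := h0
      rw [sub_zero]
      exact (hone k x hk).trans (dvd_prod_of_mem _ (mem_univ k))
  have hexp : (p : WittVector p F) ^ (h * b) ∣ ∑ x : Fin n → F, ∏ k, (1 - G k x ^ E) := by
    simp only [sub_eq_add_neg, prod_one_add, prod_neg]
    rw [sum_comm]
    refine dvd_sum fun S _ => ?_
    rw [← mul_sum]
    refine Dvd.dvd.mul_left ?_ _
    simp only [← prod_coe_sort S]
    refine pow_dvd_sum_prod_pow (ι := S) (d := fun k => d k) hh hF (fun k => hD k) hD0 ?_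
      (fun k => (g k).support) (fun k i hi => ?_)
      (fun k i => WittVector.teichmuller p ((g k).coeff i))
    · rw [sum_coe_sort S d]
      have := sum_le_univ_sum_of_nonneg (s := S) (fun k => Nat.zero_le (d k))
      omega
    · have := MvPolynomial.le_totalDegree hi
      rw [Finsupp.sum_fintype _ _ fun _ => rfl] at this
      exact this.trans (hg k)
  rw [dvd_sub_right hexp, sum_boole, WittVector.pow_dvd_natCast_iff] at hcount
  rwa [← pow_mul, Set.ncard_eq_toFinset_card', Set.toFinset_ofPred]

end AxKatz

section WittDegree

variable {p : ℕ} [hp : Fact p.Prime]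

open WittVector in
theorem WittVector.coeff_teichmuller_mul {R : Type*} [CommRing R] [CharP R p] (r : R)
    (w : WittVector p R) (n : ℕ) : (teichmuller p r * w).coeff n = r ^ p ^ n * w.coeff n := by
  induction n generalizing r w with
  | zero => simp [mul_coeff_zero]
  | succ n ih =>
    have hdecomp (a : R) (v : WittVector p R) (m : ℕ) :
        (teichmuller p a + verschiebung v).coeff (m + 1) = v.coeff m := by
      rw [coeff_add_of_disjoint]
      · simp [teichmuller_coeff_pos p a (m + 1) (Nat.succ_pos m)]
      · rintro (_ | i)
        · right; exact verschiebung_coeff_zero v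
        · left; exact teichmuller_coeff_pos p a (i + 1) (Nat.succ_pos i)
    have hw : w = teichmuller p (w.coeff 0) + verschiebung (w.shift 1) := by
      ext m
      cases m with
      | zero => simp [add_coeff_zero]
      | succ m => rw [hdecomp, shift_coeff, add_comm]
    have hF : frobenius (teichmuller p r) = teichmuller p (r ^ p) := by
      rw [frobenius_eq_map_frobenius, map_teichmuller]; rfl
    conv_lhs => rw [hw, mul_add, ← map_mul, mul_comm _ (verschiebung _),
      ← verschiebung_mul_frobenius, hF, hdecomp, mul_comm, ih, shift_coeff]
    rw [← pow_mul, pow_succ', add_comm]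

/-- The Rees algebra of the total degree filtration on multivariate polynomials. -/
def totalDegreeRees (σ R : Type*) [CommRing R] : Subring (Polynomial (MvPolynomial σ R)) where
  carrier := {P | ∀ e, (P.coeff e).totalDegree ≤ e}
  mul_mem' {P Q} hP hQ e := by
    rw [Polynomial.coeff_mul]
    refine MvPolynomial.totalDegree_finsetSum_le fun x hx => ?_
    refine (MvPolynomial.totalDegree_mul _ _).trans ?_
    rw [← mem_antidiagonal.1 hx]
    exact add_le_add (hP _) (hQ _)
  one_mem' e := by
    rw [Polynomial.coeff_one]
    split_ifs <;> simp
  add_mem' {P Q} hP hQ e := by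
    rw [Polynomial.coeff_add]
    exact (MvPolynomial.totalDegree_add _ _).trans (max_le (hP e) (hQ e))
  zero_mem' e := by simp
  neg_mem' {P} hP e := by
    rw [Polynomial.coeff_neg, MvPolynomial.totalDegree_neg]
    exact hP e

/-- Witt vectors over a polynomial ring whose `j`-th coefficient has total degree at most
`p ^ j * d` form an additive submonoid. -/
def wittDegreeLE (p : ℕ) [Fact p.Prime] (σ R : Type*) [CommRing R] [CharP R p] (d : ℕ) :
    AddSubmonoid (WittVector p (MvPolynomial σ R)) where
  carrier := {w | ∀ j, (w.coeff j).totalDegree ≤ p ^ j * d}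
  zero_mem' j := by simp
  add_mem' {v w} hv hw := by
    let T : WittVector p (Polynomial (MvPolynomial σ R)) :=
      WittVector.teichmuller p (Polynomial.X ^ d)
    let C : WittVector p (MvPolynomial σ R) →+* WittVector p (Polynomial (MvPolynomial σ R)) :=
      WittVector.map Polynomial.C
    let ι : WittVector p (totalDegreeRees σ R) →+* WittVector p (Polynomial (MvPolynomial σ R)) :=
      WittVector.map (totalDegreeRees σ R).subtype
    have hcoeff (x : WittVector p (MvPolynomial σ R)) (j : ℕ) :
        (T * C x).coeff j = Polynomial.C (x.coeff j) * Polynomial.X ^ (p ^ j * d) := by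
      rw [WittVector.coeff_teichmuller_mul, WittVector.map_coeff, ← pow_mul, mul_comm, mul_comm d]
    have hlift (x : WittVector p (MvPolynomial σ R))
        (hx : ∀ j, (x.coeff j).totalDegree ≤ p ^ j * d) : ∃ y, ι y = T * C x := by
      refine ⟨WittVector.mk p fun j => ⟨(T * C x).coeff j, fun e => ?_⟩, ?_⟩
      · rw [hcoeff, Polynomial.coeff_C_mul_X_pow]
        split_ifs with he
        · exact he ▸ hx j
        · simp
      · ext1 j
        rw [WittVector.map_coeff]; rfl
    obtain ⟨v', hv'⟩ := hlift v hv
    obtain ⟨w', hw'⟩ := hlift w hw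
    intro j
    have h1 : (T * C (v + w)).coeff j = ((v' + w').coeff j : Polynomial (MvPolynomial σ R)) := by
      rw [map_add, mul_add, ← hv', ← hw', ← map_add, WittVector.map_coeff]; rfl
    have h2 := ((v' + w').coeff j).2 (p ^ j * d)
    rwa [← h1, hcoeff, Polynomial.coeff_C_mul_X_pow, if_pos rfl] at h2

theorem exists_coeff_eval_teichmuller_eq {σ R : Type*} [CommRing R] [CharP R p]
    (f : MvPolynomial σ (WittVector p R)) :
    ∃ g : ℕ → MvPolynomial σ R, (∀ j, (g j).totalDegree ≤ p ^ j * f.totalDegree) ∧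
      ∀ (x : σ → R) j, (MvPolynomial.eval (fun i => WittVector.teichmuller p (x i)) f).coeff j =
        MvPolynomial.eval x (g j) := by
  let w : WittVector p (MvPolynomial σ R) := ∑ i ∈ f.support,
    WittVector.teichmuller p (MvPolynomial.monomial i 1) *
      WittVector.map MvPolynomial.C (f.coeff i)
  refine ⟨w.coeff, ?_, fun x j => ?_⟩
  · have hw : w ∈ wittDegreeLE p σ R f.totalDegree := by
      refine sum_mem fun i hi j => ?_
      rw [WittVector.coeff_teichmuller_mul, WittVector.map_coeff, MvPolynomial.monomial_pow,
        mul_comm, one_pow, MvPolynomial.C_mul_monomial]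
      refine (MvPolynomial.totalDegree_monomial_le _ _).trans ?_
      have := MvPolynomial.le_totalDegree hi
      rw [Finsupp.sum_smul_index (fun _ => rfl)]
      simp only [id, Finsupp.sum, ← mul_sum] at this ⊢
      gcongr
    exact hw
  · rw [← WittVector.map_coeff (MvPolynomial.eval x) w]
    congr 1
    rw [map_sum, MvPolynomial.eval_eq]
    refine sum_congr rfl fun i _ => ?_
    rw [map_mul, WittVector.map_teichmuller, MvPolynomial.eval_monomial, one_mul, mul_comm,
      Finsupp.prod, map_prod]
    congr 1
    · simp
    · ext n
      simp [WittVector.map_coeff]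

end WittDegree

/-- Weak version for a system over the Teichmüller box: for nonzero
`f_1,…,f_s ∈ ℤ_q[x_1,…,x_n]` (with `ℤ_q` modeled as Witt vectors over `F = 𝔽_q`),
`m_k ≥ 1`, and `V = {X ∈ T_q^n : p^{m_k} ∣ f_k(X) ∀k}`, one has
`ord_q |V| ≥ ⌈(n − Σ_k ((p^{m_k}−1)/(p−1))·deg f_k) / max_k (p^{m_k−1}·deg f_k)⌉*`. -/
theorem stmt13 (p h n s : ℕ) [Fact p.Prime] (hh : 0 < h) (hn : 0 < n) (hs : 0 < s)
    (F : Type) [Field F] [Fintype F] [CharP F p] (hF : Fintype.card F = p ^ h)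
    (f : Fin s → MvPolynomial (Fin n) (WittVector p F)) (hf : ∀ k, f k ≠ 0)
    (m : Fin s → ℕ) (hm : ∀ k, 1 ≤ m k) :
    (p ^ h) ^ (max 0 ⌈((n : ℚ) -
          ∑ k, ((p : ℚ) ^ m k - 1) / ((p : ℚ) - 1) * (f k).totalDegree) /
        ((Finset.univ.sup fun k => p ^ (m k - 1) * (f k).totalDegree : ℕ) : ℚ)⌉).toNat ∣
      {X : Fin n → WittVector p F |
        (∀ i, X i ∈ Set.range (WittVector.teichmuller p (R := F))) ∧
        ∀ k, (p : WittVector p F) ^ m k ∣ MvPolynomial.eval X (f k)}.ncard := by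
  classical
  have hp1 : 1 < p := Fact.out (p := p.Prime).one_lt
  set D := Finset.univ.sup fun k => p ^ (m k - 1) * (f k).totalDegree with hD
  set t := ((n : ℚ) - ∑ k, ((p : ℚ) ^ m k - 1) / ((p : ℚ) - 1) * (f k).totalDegree) / (D : ℚ)
    with ht
  set b := (max 0 ⌈t⌉).toNat with hb
  rcases Nat.eq_zero_or_pos b with hb0 | hb0
  · simp [hb0]
  rcases Nat.eq_zero_or_pos D with hD0 | hD0
  · simp [hb, ht, hD0] at hb0
  choose g hgdeg hgeval using fun k => exists_coeff_eval_teichmuller_eq (f k)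
  have hcard : {X : Fin n → WittVector p F |
        (∀ i, X i ∈ Set.range (WittVector.teichmuller p (R := F))) ∧
        ∀ k, (p : WittVector p F) ^ m k ∣ MvPolynomial.eval X (f k)}.ncard =
      {x : Fin n → F | ∀ k : (Σ k, Fin (m k)), MvPolynomial.eval x (g k.1 k.2) = 0}.ncard := by
    rw [← Set.ncard_image_of_injective _
      ((WittVector.teichmuller_injective p F).comp_left (α := Fin n))]
    congr 1
    ext X
    have hdvd (x : Fin n → F) : (∀ k, (p : WittVector p F) ^ m k ∣
          MvPolynomial.eval (fun i => WittVector.teichmuller p (x i)) (f k)) ↔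
        ∀ k : (Σ k, Fin (m k)), MvPolynomial.eval x (g k.1 k.2) = 0 := by
      simp only [← Ideal.mem_span_singleton, WittVector.mem_span_p_pow_iff_le_coeff_eq_zero,
        hgeval, Sigma.forall, Fin.forall_iff]
    constructor
    · rintro ⟨hX, hk⟩
      choose x hx using hX
      obtain rfl : (fun i => WittVector.teichmuller p (x i)) = X := funext hx
      exact ⟨x, (hdvd x).1 hk, rfl⟩
    · rintro ⟨x, hx, rfl⟩
      exact ⟨fun i => ⟨x i, rfl⟩, (hdvd x).2 hx⟩
  rw [hcard]
  refine ax_katz (D := D) (d := fun k : (Σ k, Fin (m k)) => p ^ (k.2 : ℕ) * (f k.1).totalDegree)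
    hh hF (fun k => ?_) hD0 ?_ _ fun k => hgdeg k.1 k.2
  · refine le_trans ?_ (Finset.le_sup (f := fun k => p ^ (m k - 1) * (f k).totalDegree)
      (Finset.mem_univ k.1))
    exact Nat.mul_le_mul_right _ (Nat.pow_le_pow_right hp1.le (by omega))
  · have hsum : ∑ k, ((p : ℚ) ^ m k - 1) / ((p : ℚ) - 1) * (f k).totalDegree =
        ((∑ k : (Σ k, Fin (m k)), p ^ (k.2 : ℕ) * (f k.1).totalDegree : ℕ) : ℚ) := by
      rw [Fintype.sum_sigma]
      push_cast
      refine Finset.sum_congr rfl fun k _ => ?_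
      rw [← Finset.sum_mul, Fin.sum_univ_eq_sum_range (fun j => (p : ℚ) ^ j),
        geom_sum_eq (by exact_mod_cast hp1.ne')]
    have hceil : (b : ℤ) = ⌈t⌉ := by omega
    have hlt : (b : ℚ) - 1 < t := by
      have := Int.ceil_lt_add_one t
      rw [← hceil] at this
      push_cast at this
      linarith
    rw [ht, hsum, lt_div_iff₀ (by exact_mod_cast hD0)] at hlt
    have : (D : ℚ) * b + (∑ k : (Σ k, Fin (m k)), p ^ (k.2 : ℕ) * (f k.1).totalDegree : ℕ) <
        n + D := by linarith
    exact_mod_cast this
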